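/- Let Π be a singular Poisson bivector on U∖S with a singularity at m ∈ S. Then the singularity of Π at m is removable if and only if there exist an open neighborhood V ⊆ U of m, a smooth function f : V → ℝ, and a smooth map ψ : V → Λℝⁿ with ψ(x) ≠ 0 for every x ∈ V, such that ψ(x) = f(x)·e^{−Π̂(x)} for all x ∈ V∖S. -/

import Mathlib

noncomputable section

/-- Partial derivative `∂ᵢ f (x)`. -/
def pd {n : ℕ} (f : (Fin n → ℝ) → ℝ) (i : Fin n) (x : Fin n → ℝ) : ℝ :=
  fderiv ℝ f x (Pi.single i 1)

/-- The graph `{(Π α, α) : α ∈ (ℝⁿ)*} ⊆ ℝⁿ × (ℝⁿ)*` of the bivector with component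
matrix `A` (so `(Πα)ᵢ = Σⱼ Aᵢⱼ αⱼ`), identifying `(ℝⁿ)*` with `ℝⁿ` via the dual
standard basis. -/
def graphBivec {n : ℕ} (A : Fin n → Fin n → ℝ) : Submodule ℝ ((Fin n → ℝ) × (Fin n → ℝ)) :=
  LinearMap.range (((Matrix.of A).mulVecLin).prod LinearMap.id)

/-- A singular Poisson bivector on `U∖S`: smooth there, skew-symmetric, and
satisfying the Jacobi identity
`Σ_l (Π_{li} ∂_l Π_{jk} + Π_{lj} ∂_l Π_{ki} + Π_{lk} ∂_l Π_{ij}) = 0`. -/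
def IsSingularPoisson {n : ℕ} (U S : Set (Fin n → ℝ))
    (P : (Fin n → ℝ) → Fin n → Fin n → ℝ) : Prop :=
  ContDiffOn ℝ (⊤ : ℕ∞) P (U \ S) ∧ (∀ x ∈ U \ S, ∀ i j, P x i j = - P x j i) ∧
    ∀ x ∈ U \ S, ∀ i j k,
      ∑ l, (P x l i * pd (fun y => P y j k) l x + P x l j * pd (fun y => P y k i) l x +
        P x l k * pd (fun y => P y i j) l x) = 0

/-- `P` has a singularity at `m ∈ S`: no smooth skew-symmetric extension of `P` to
an open neighborhood of `m` inside `U`. -/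
def PoissonHasSingularityAt {n : ℕ} (U S : Set (Fin n → ℝ))
    (P : (Fin n → ℝ) → Fin n → Fin n → ℝ) (m : Fin n → ℝ) : Prop :=
  ¬ ∃ (W : Set (Fin n → ℝ)) (P' : (Fin n → ℝ) → Fin n → Fin n → ℝ),
      IsOpen W ∧ m ∈ W ∧ W ⊆ U ∧ ContDiffOn ℝ (⊤ : ℕ∞) P' W ∧
      (∀ x ∈ W, ∀ i j, P' x i j = - P' x j i) ∧ ∀ x ∈ W \ S, P' x = P x

/-- The singularity of the Poisson bivector `P` at `m` is removable in its graph. -/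
def PoissonRemovableAt {n : ℕ} (U S : Set (Fin n → ℝ))
    (P : (Fin n → ℝ) → Fin n → Fin n → ℝ) (m : Fin n → ℝ) : Prop :=
  ∃ (V : Set (Fin n → ℝ)) (s : Fin n → (Fin n → ℝ) → (Fin n → ℝ) × (Fin n → ℝ)),
    IsOpen V ∧ m ∈ V ∧ V ⊆ U ∧
    (∀ i, ContDiffOn ℝ (⊤ : ℕ∞) (s i) V) ∧
    (∀ x ∈ V, LinearIndependent ℝ (fun i => s i x)) ∧
    ∀ x ∈ V \ S, Submodule.span ℝ (Set.range fun i => s i x) = graphBivec (P x)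

/-- `ω̂ = Σ_{i<j} A_{ij} e^i ∧ e^j` in the exterior algebra of `ℝⁿ`
(our model for `Λ(ℝⁿ)*`, identifying `(ℝⁿ)*` with `ℝⁿ` via the standard basis). -/
def hatTwoForm {n : ℕ} (A : Fin n → Fin n → ℝ) : ExteriorAlgebra ℝ (Fin n → ℝ) :=
  ∑ i : Fin n, ∑ j : Fin n,
    if i < j then
      A i j • (ExteriorAlgebra.ι ℝ (Pi.single i 1) * ExteriorAlgebra.ι ℝ (Pi.single j 1))
    else 0

/-- `e^{-ω̂} = Σ_{k≥0} (-1)^k ω̂^{∧k}/k!` (a finite sum: all terms with `2k > n`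
vanish). -/
def expNegHat {n : ℕ} (A : Fin n → Fin n → ℝ) : ExteriorAlgebra ℝ (Fin n → ℝ) :=
  ∑ k ∈ Finset.range (n / 2 + 1), ((-1 : ℝ) ^ k / (Nat.factorial k : ℝ)) • hatTwoForm A ^ k

/-- The coefficient of `φ ∈ Λℝⁿ` on the wedge monomial `e^T = e_{t₁} ∧ ⋯ ∧ e_{tₖ}`
(`T = {t₁ < ⋯ < tₖ}`), extracted by successive contraction with the dual basis
functionals and taking the scalar part. -/
def monCoeff {n : ℕ} (T : Finset (Fin n)) (φ : ExteriorAlgebra ℝ (Fin n → ℝ)) : ℝ :=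
  ExteriorAlgebra.algebraMapInv
    ((T.sort (· ≤ ·)).foldl
      (fun ψ i =>
        CliffordAlgebra.contractLeft (M := Fin n → ℝ)
          (LinearMap.proj i : Module.Dual ℝ (Fin n → ℝ)) ψ)
      φ)

open CliffordAlgebra (contractLeft)

namespace ExteriorAlgebra

/-- Contraction by the `i`-th coordinate functional. -/
abbrev coordContract {n : ℕ} (i : Fin n) : Module.End ℝ (ExteriorAlgebra ℝ (Fin n → ℝ)) :=
  contractLeft (LinearMap.proj i : Module.Dual ℝ (Fin n → ℝ))

lemma algebraMapInv_ι_mul {M : Type*} [AddCommGroup M] [Module ℝ M] (v : M)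
    (φ : ExteriorAlgebra ℝ M) : algebraMapInv (ι ℝ v * φ) = 0 := by
  simp [algebraMapInv]

lemma ι_mul_ι_mul_swap {M : Type*} [AddCommGroup M] [Module ℝ M] (u v : M)
    (φ : ExteriorAlgebra ℝ M) : ι ℝ u * (ι ℝ v * φ) = -(ι ℝ v * (ι ℝ u * φ)) := by
  rw [← mul_assoc, ← mul_assoc, eq_neg_iff_add_eq_zero, ← add_mul, ι_add_mul_swap, zero_mul]

lemma contractLeft_ι_mul' {M : Type*} [AddCommGroup M] [Module ℝ M] (d : Module.Dual ℝ M) (v : M)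
    (φ : ExteriorAlgebra ℝ M) :
    contractLeft d (ι ℝ v * φ) = d v • φ - ι ℝ v * contractLeft d φ :=
  CliffordAlgebra.contractLeft_ι_mul d v φ

/-- Iterating `φ ↦ φ - e_i ∧ ι_i φ`, projecting away all monomials divisible by some `e_i`. -/
def projList {n : ℕ} (l : List (Fin n)) (φ : ExteriorAlgebra ℝ (Fin n → ℝ)) :
    ExteriorAlgebra ℝ (Fin n → ℝ) :=
  l.foldr (fun i χ => coordContract i (ι ℝ (Pi.single i 1) * χ)) φ

lemma projList_add {n : ℕ} (l : List (Fin n)) (φ χ : ExteriorAlgebra ℝ (Fin n → ℝ)) :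
    projList l (φ + χ) = projList l φ + projList l χ := by
  induction l with
  | nil => rfl
  | cons i l ih => simp only [projList, List.foldr_cons] at ih ⊢; rw [ih, mul_add, map_add]

lemma projList_smul {n : ℕ} (l : List (Fin n)) (c : ℝ) (φ : ExteriorAlgebra ℝ (Fin n → ℝ)) :
    projList l (c • φ) = c • projList l φ := by
  induction l with
  | nil => rfl
  | cons i l ih => simp only [projList, List.foldr_cons] at ih ⊢; rw [ih, mul_smul_comm, map_smul]

lemma projList_one {n : ℕ} (l : List (Fin n)) :
    projList l (1 : ExteriorAlgebra ℝ (Fin n → ℝ)) = 1 := by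
  induction l with
  | nil => rfl
  | cons i l ih =>
    simp only [projList, List.foldr_cons] at ih ⊢
    rw [ih, contractLeft_ι_mul']
    simp

lemma projList_ι_mul {n : ℕ} (l : List (Fin n)) (k : Fin n)
    (φ : ExteriorAlgebra ℝ (Fin n → ℝ)) :
    projList l (ι ℝ (Pi.single k 1) * φ) =
      if k ∈ l then 0 else ι ℝ (Pi.single k 1) * projList l φ := by
  induction l with
  | nil => simp [projList]
  | cons i l ih =>
    simp only [projList, List.foldr_cons] at ih ⊢
    rw [ih]
    by_cases hk : k ∈ l
    · simp [hk]
    by_cases hki : k = i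
    · subst hki
      simp [hk, ← mul_assoc]
    · simp only [hk, if_false, List.mem_cons, hki, false_or]
      rw [ι_mul_ι_mul_swap, map_neg, contractLeft_ι_mul']
      simp [Ne.symm hki]

lemma projList_finRange {n : ℕ} (φ : ExteriorAlgebra ℝ (Fin n → ℝ)) :
    projList (List.finRange n) φ = algebraMapInv φ • 1 := by
  induction φ using CliffordAlgebra.left_induction with
  | algebraMap r =>
    have h := algebraMap_leftInverse (R := ℝ) (Fin n → ℝ) r
    change projList _ (algebraMap ℝ (ExteriorAlgebra ℝ (Fin n → ℝ)) r) =
      algebraMapInv (algebraMap ℝ (ExteriorAlgebra ℝ (Fin n → ℝ)) r) • 1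
    rw [h, Algebra.algebraMap_eq_smul_one, projList_smul, projList_one]
  | add x y hx hy => rw [projList_add, hx, hy, map_add, add_smul]
  | ι_mul x v _ =>
    change projList _ (ι ℝ v * x) = algebraMapInv (ι ℝ v * x) • 1
    rw [algebraMapInv_ι_mul, zero_smul, pi_eq_sum_univ' v, map_sum, Finset.sum_mul]
    have (s : Finset (Fin n)) : projList (List.finRange n)
        (∑ i ∈ s, ι ℝ (v i • Pi.single i (1 : ℝ)) * x) = 0 := by
      induction s using Finset.induction_on with
      | empty => simpa using projList_smul (List.finRange n) 0 0
      | insert a s ha ih =>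
        rw [Finset.sum_insert ha, projList_add, ih, map_smul, smul_mul_assoc, projList_smul,
          projList_ι_mul]
        simp
    exact this Finset.univ

/-- A multivector all of whose contractions vanish is a scalar. -/
lemma eq_smul_one_of_contract_eq_zero {n : ℕ} {φ : ExteriorAlgebra ℝ (Fin n → ℝ)}
    (h : ∀ i, coordContract i φ = 0) : φ = algebraMapInv φ • 1 := by
  rw [← projList_finRange]
  induction List.finRange n with
  | nil => rfl
  | cons i l ih =>
    simp only [projList, List.foldr_cons] at ih ⊢
    rw [← ih, contractLeft_ι_mul', h i]
    simp

lemma eq_zero_of_forall_sublist {n : ℕ} (l : List (Fin n)) (φ : ExteriorAlgebra ℝ (Fin n → ℝ))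
    (h : ∀ i ∉ l, coordContract i φ = 0)
    (hl : ∀ l' : List (Fin n), l'.Sublist l →
      algebraMapInv (R := ℝ) (M := Fin n → ℝ) (l'.foldl (fun χ i => coordContract i χ) φ) = 0) :
    φ = 0 := by
  induction l generalizing φ with
  | nil =>
    rw [eq_smul_one_of_contract_eq_zero (fun i => h i (by simp))]
    have := hl [] (by simp)
    simp only [List.foldl_nil] at this
    rw [this, zero_smul]
  | cons i l ih =>
    have hi : coordContract i φ = 0 := by
      refine ih _ (fun j hj => ?_) (fun l' hl' => hl (i :: l') (hl'.cons_cons i))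
      by_cases hji : j = i
      · subst hji
        exact CliffordAlgebra.contractLeft_contractLeft _ _
      · rw [coordContract, coordContract, CliffordAlgebra.contractLeft_comm]
        have := h j (by simp [hj, hji])
        rw [coordContract] at this
        rw [this]; simp
    refine ih φ (fun j hj => ?_) (fun l' hl' => hl l' (hl'.cons i))
    by_cases hji : j = i
    · exact hji ▸ hi
    · exact h j (by simp [hj, hji])

end ExteriorAlgebra

open ExteriorAlgebra

lemma eq_zero_of_monCoeff_eq_zero {n : ℕ} {φ : ExteriorAlgebra ℝ (Fin n → ℝ)}
    (h : ∀ T, monCoeff T φ = 0) : φ = 0 := by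
  refine eq_zero_of_forall_sublist (List.finRange n) φ (by simp) fun l hl => ?_
  have := h l.toFinset
  rw [monCoeff] at this
  rwa [(List.toFinset_sort (· ≤ ·) (hl.nodup (List.nodup_finRange n))).2
    ((List.pairwise_le_finRange n).sublist hl)] at this

/-- The coefficient on a wedge monomial, as a linear functional. -/
def monCoeffLinear {n : ℕ} (T : Finset (Fin n)) :
    Module.Dual ℝ (ExteriorAlgebra ℝ (Fin n → ℝ)) :=
  algebraMapInv.toLinearMap ∘ₗ
    (T.sort (· ≤ ·)).foldl (fun (g : Module.End ℝ _) i => coordContract i * g) 1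

lemma monCoeffLinear_apply {n : ℕ} (T : Finset (Fin n)) (φ : ExteriorAlgebra ℝ (Fin n → ℝ)) :
    monCoeffLinear T φ = monCoeff T φ := by
  have (l : List (Fin n)) (g : Module.End ℝ (ExteriorAlgebra ℝ (Fin n → ℝ))) :
      l.foldl (fun g i => coordContract i * g) g φ =
        l.foldl (fun χ i => coordContract i χ) (g φ) := by
    induction l generalizing g with
    | nil => rfl
    | cons i l ih => exact ih (coordContract i * g)
  simp only [monCoeffLinear, LinearMap.comp_apply, this]
  rfl

lemma dual_mem_span_monCoeffLinear {n : ℕ} (L : Module.Dual ℝ (ExteriorAlgebra ℝ (Fin n → ℝ))) :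
    L ∈ Submodule.span ℝ (Set.range (monCoeffLinear (n := n))) := by
  refine mem_span_of_iInf_ker_le_ker fun φ hφ => ?_
  simp only [Submodule.mem_iInf, LinearMap.mem_ker, monCoeffLinear_apply] at hφ
  rw [eq_zero_of_monCoeff_eq_zero hφ]
  exact Submodule.zero_mem _

/-- The functional `v ↦ ∑ i, α i * v i` associated with a coordinate vector `α`. -/
def coordDual {n : ℕ} : (Fin n → ℝ) →ₗ[ℝ] Module.Dual ℝ (Fin n → ℝ) :=
  (Pi.basisFun ℝ (Fin n)).toDual

lemma coordDual_apply {n : ℕ} (α v : Fin n → ℝ) : coordDual α v = ∑ i, α i * v i := by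
  conv_lhs => rw [← (Pi.basisFun ℝ (Fin n)).sum_repr α, ← (Pi.basisFun ℝ (Fin n)).sum_repr v]
  simp only [coordDual, map_sum, map_smul, LinearMap.sum_apply, LinearMap.smul_apply,
    Module.Basis.toDual_apply]
  simp [mul_comm]

lemma coordDual_single {n : ℕ} (α : Fin n → ℝ) (i : Fin n) :
    coordDual α (Pi.single i 1) = α i := by
  simp [coordDual_apply, Pi.single_apply]

lemma coordDual_single_left {n : ℕ} (i : Fin n) :
    coordDual (Pi.single i 1) = (LinearMap.proj i : Module.Dual ℝ (Fin n → ℝ)) := by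
  ext j
  simp [coordDual_apply, Pi.single_apply, eq_comm]

lemma commute_ι_hatTwoForm {n : ℕ} (A : Fin n → Fin n → ℝ) (v : Fin n → ℝ) :
    Commute (ι ℝ v) (hatTwoForm A) := by
  refine Commute.sum_right _ _ _ fun i _ => Commute.sum_right _ _ _ fun j _ => ?_
  split_ifs
  · refine Commute.smul_right ?_ _
    have := ι_mul_ι_mul_swap v (Pi.single i 1) (ι ℝ (Pi.single j (1 : ℝ)))
    rw [commute_iff_eq, this, eq_neg_of_add_eq_zero_left (ι_add_mul_swap v (Pi.single j 1)),
      mul_neg, neg_neg, mul_assoc]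
  · exact Commute.zero_right _

lemma contractLeft_hatTwoForm_mul {n : ℕ} {A : Fin n → Fin n → ℝ} (hA : ∀ i j, A i j = -A j i)
    (α : Fin n → ℝ) (φ : ExteriorAlgebra ℝ (Fin n → ℝ)) :
    contractLeft (coordDual α) (hatTwoForm A * φ) =
      hatTwoForm A * contractLeft (coordDual α) φ - ι ℝ ((Matrix.of A).mulVec α) * φ := by
  have hsum : ∑ i, ∑ j, (if i < j then A i j • (α i • ι ℝ (Pi.single j (1 : ℝ)) -
      α j • ι ℝ (Pi.single i (1 : ℝ))) else 0) = -ι ℝ ((Matrix.of A).mulVec α) := by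
    have h1 : ∑ i, ∑ j, (if i < j then A i j • (α i • ι ℝ (Pi.single j (1 : ℝ)) -
        α j • ι ℝ (Pi.single i (1 : ℝ))) else 0) =
        (∑ i, ∑ j, if i < j then A i j • (α i • ι ℝ (Pi.single j (1 : ℝ))) else 0) -
        ∑ i, ∑ j, if i < j then A i j • (α j • ι ℝ (Pi.single i (1 : ℝ))) else 0 := by
      simp only [← Finset.sum_sub_distrib]
      refine Finset.sum_congr rfl fun i _ => Finset.sum_congr rfl fun j _ => ?_
      split_ifs <;> simp [smul_sub]
    have h2 : ι ℝ ((Matrix.of A).mulVec α) =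
        ∑ i, ∑ j, A i j • (α j • ι ℝ (Pi.single i (1 : ℝ))) := by
      rw [pi_eq_sum_univ' ((Matrix.of A).mulVec α), map_sum]
      refine Finset.sum_congr rfl fun i _ => ?_
      rw [map_smul]
      simp only [smul_smul, ← Finset.sum_smul]
      rfl
    rw [h1, Finset.sum_comm, h2, ← Finset.sum_sub_distrib, ← Finset.sum_neg_distrib]
    refine Finset.sum_congr rfl fun i _ => ?_
    rw [← Finset.sum_sub_distrib, ← Finset.sum_neg_distrib]
    refine Finset.sum_congr rfl fun j _ => ?_
    rcases lt_trichotomy i j with h | h | h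
    · simp [h, h.not_gt]
    · subst h
      have : A i i = 0 := by linarith [hA i i]
      simp [this]
    · simp [h, h.not_gt, hA j i]
  rw [sub_eq_add_neg, ← neg_mul, ← hsum]
  simp only [hatTwoForm, Finset.sum_mul, map_sum, ← Finset.sum_add_distrib]
  refine Finset.sum_congr rfl fun i _ => Finset.sum_congr rfl fun j _ => ?_
  split_ifs
  · simp only [smul_mul_assoc, map_smul, mul_assoc, contractLeft_ι_mul', coordDual_single,
      sub_mul, mul_sub, mul_smul_comm, smul_sub]
    abel
  · simp

lemma contractLeft_hatTwoForm_pow_mul {n : ℕ} {A : Fin n → Fin n → ℝ}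
    (hA : ∀ i j, A i j = -A j i) (α : Fin n → ℝ) (k : ℕ)
    (φ : ExteriorAlgebra ℝ (Fin n → ℝ)) :
    contractLeft (coordDual α) (hatTwoForm A ^ k * φ) =
      hatTwoForm A ^ k * contractLeft (coordDual α) φ -
        (k : ℝ) • (ι ℝ ((Matrix.of A).mulVec α) * (hatTwoForm A ^ (k - 1) * φ)) := by
  induction k with
  | zero => simp
  | succ k ih =>
    have hc := (commute_ι_hatTwoForm A ((Matrix.of A).mulVec α)).eq
    rw [pow_succ', mul_assoc, contractLeft_hatTwoForm_mul hA, ih, mul_sub, mul_smul_comm,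
      ← mul_assoc (hatTwoForm A) (ι ℝ _), ← hc]
    rcases k with _ | k
    · simp
    · simp only [mul_assoc, Nat.add_sub_cancel, pow_succ', Nat.cast_add, Nat.cast_one, add_smul,
        one_smul]
      abel

lemma hatTwoForm_pow_eq_zero {n : ℕ} (A : Fin n → Fin n → ℝ) :
    hatTwoForm A ^ (n / 2 + 1) = 0 := by
  have h2 : hatTwoForm A ∈ (LinearMap.range (ι ℝ : (Fin n → ℝ) →ₗ[ℝ] _)) ^ 2 := by
    refine Submodule.sum_mem _ fun i _ => Submodule.sum_mem _ fun j _ => ?_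
    split_ifs
    · rw [pow_two]
      exact Submodule.smul_mem _ _ (Submodule.mul_mem_mul ⟨_, rfl⟩ ⟨_, rfl⟩)
    · exact Submodule.zero_mem _
  have h3 := Submodule.pow_mem_pow _ h2 (n / 2 + 1)
  rw [← pow_mul] at h3
  have h4 : Module.finrank ℝ (⋀[ℝ]^(2 * (n / 2 + 1)) (Fin n → ℝ)) = 0 := by
    rw [exteriorPower.finrank_eq, Module.finrank_fin_fun]
    exact Nat.choose_eq_zero_of_lt (by omega)
  have h5 := Submodule.finrank_eq_zero.1 h4
  exact (Submodule.eq_bot_iff _).1 h5 _ h3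

lemma contractLeft_expNegHat_mul {n : ℕ} {A : Fin n → Fin n → ℝ} (hA : ∀ i j, A i j = -A j i)
    (α : Fin n → ℝ) (φ : ExteriorAlgebra ℝ (Fin n → ℝ)) :
    contractLeft (coordDual α) (expNegHat A * φ) =
      expNegHat A * contractLeft (coordDual α) φ +
        ι ℝ ((Matrix.of A).mulVec α) * (expNegHat A * φ) := by
  set X := (Matrix.of A).mulVec α with hX
  have htop : ι ℝ X * (hatTwoForm A ^ (n / 2) * φ) = 0 := by
    have h := contractLeft_hatTwoForm_pow_mul hA α (n / 2 + 1) φ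
    rw [hatTwoForm_pow_eq_zero, zero_mul, zero_mul, map_zero, Nat.add_sub_cancel, zero_sub,
      eq_comm, neg_eq_zero] at h
    exact (smul_eq_zero.1 h).resolve_left (by positivity)
  have hsum : ∑ k ∈ Finset.range (n / 2 + 1), ((-1 : ℝ) ^ k / (k.factorial : ℝ)) •
      ((k : ℝ) • (ι ℝ X * (hatTwoForm A ^ (k - 1) * φ))) =
      -∑ k ∈ Finset.range (n / 2 + 1), ((-1 : ℝ) ^ k / (k.factorial : ℝ)) •
        (ι ℝ X * (hatTwoForm A ^ k * φ)) := by
    rw [Finset.sum_range_succ', Finset.sum_range_succ, htop]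
    simp only [Nat.cast_zero, zero_smul, smul_zero, add_zero, Nat.add_sub_cancel]
    rw [← Finset.sum_neg_distrib]
    refine Finset.sum_congr rfl fun k _ => ?_
    rw [smul_smul, ← neg_smul]
    congr 1
    rw [Nat.factorial_succ]
    push_cast
    field_simp
    ring
  simp only [expNegHat, Finset.sum_mul, Finset.mul_sum, map_sum, smul_mul_assoc, map_smul,
    mul_smul_comm, contractLeft_hatTwoForm_pow_mul hA, smul_sub, Finset.sum_sub_distrib, ← hX]
  rw [hsum, sub_neg_eq_add]

lemma algebraMapInv_hatTwoForm {n : ℕ} (A : Fin n → Fin n → ℝ) :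
    algebraMapInv (hatTwoForm A) = 0 := by
  simp only [hatTwoForm, map_sum]
  refine Finset.sum_eq_zero fun i _ => Finset.sum_eq_zero fun j _ => ?_
  split_ifs
  · rw [map_smul, algebraMapInv_ι_mul, smul_zero]
  · exact map_zero _

lemma algebraMapInv_expNegHat {n : ℕ} (A : Fin n → Fin n → ℝ) :
    algebraMapInv (expNegHat A) = 1 := by
  rw [expNegHat, Finset.sum_range_succ', map_add, map_sum, Finset.sum_eq_zero]
  · simp
  · intro k _
    rw [map_smul, map_pow, algebraMapInv_hatTwoForm]
    simp

lemma expNegHat_mul_eq_smul_one {n : ℕ} {A : Fin n → Fin n → ℝ} (hA : ∀ i j, A i j = -A j i)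
    {φ : ExteriorAlgebra ℝ (Fin n → ℝ)}
    (hφ : ∀ α, contractLeft (coordDual α) φ = -(ι ℝ ((Matrix.of A).mulVec α) * φ)) :
    expNegHat A * φ = algebraMapInv φ • 1 := by
  have hc (v : Fin n → ℝ) : Commute (ι ℝ v) (expNegHat A) :=
    Commute.sum_right _ _ _ fun k _ => ((commute_ι_hatTwoForm A v).pow_right k).smul_right _
  rw [eq_smul_one_of_contract_eq_zero (φ := expNegHat A * φ), map_mul, algebraMapInv_expNegHat,
    one_mul]
  intro i
  rw [coordContract, ← coordDual_single_left, contractLeft_expNegHat_mul hA, hφ, mul_neg,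
    ← mul_assoc, ← mul_assoc, (hc _).eq, neg_add_cancel]

lemma expNegHat_neg_mul {n : ℕ} {A : Fin n → Fin n → ℝ} (hA : ∀ i j, A i j = -A j i) :
    expNegHat A * expNegHat (-A) = 1 := by
  have hA' : ∀ i j, (-A) i j = -(-A) j i := fun i j => by
    simp only [Pi.neg_apply]; rw [hA i j]
  rw [expNegHat_mul_eq_smul_one hA, algebraMapInv_expNegHat, one_smul]
  intro α
  have h := contractLeft_expNegHat_mul hA' α 1
  have h2 : (Matrix.of (-A)).mulVec α = -(Matrix.of A).mulVec α := Matrix.neg_mulVec _ _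
  rw [mul_one, CliffordAlgebra.contractLeft_one, mul_zero, zero_add, h2, map_neg, neg_mul] at h
  exact h

/-- A multivector `φ` satisfying `ι_α φ = (Aα) ∧ φ` for all `α` is a multiple of the
exponential spinor of `A`. -/
lemma eq_smul_expNegHat {n : ℕ} {A : Fin n → Fin n → ℝ} (hA : ∀ i j, A i j = -A j i)
    {φ : ExteriorAlgebra ℝ (Fin n → ℝ)}
    (hφ : ∀ α, contractLeft (coordDual α) φ = ι ℝ ((Matrix.of A).mulVec α) * φ) :
    φ = algebraMapInv φ • expNegHat A := by
  have hA' : ∀ i j, (-A) i j = -(-A) j i := fun i j => by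
    simp only [Pi.neg_apply]; rw [hA i j]
  have h : expNegHat (-A) * φ = algebraMapInv φ • 1 := by
    refine expNegHat_mul_eq_smul_one hA' fun α => ?_
    have h2 : (Matrix.of (-A)).mulVec α = -(Matrix.of A).mulVec α := Matrix.neg_mulVec _ _
    rw [hφ, h2, map_neg, neg_mul, neg_neg]
  rw [← one_mul φ, ← expNegHat_neg_mul hA, mul_assoc, h, mul_smul_comm, mul_one, map_smul,
    algebraMapInv_expNegHat, smul_eq_mul, mul_one]

/-- The spinor action of `TM ⊕ T*M` on multivectors, `(X, α) • φ = ι_α φ - X ∧ φ`. -/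
def spinorAction {n : ℕ} :
    (Fin n → ℝ) × (Fin n → ℝ) →ₗ[ℝ] Module.End ℝ (ExteriorAlgebra ℝ (Fin n → ℝ)) :=
  contractLeft ∘ₗ coordDual ∘ₗ LinearMap.snd ℝ _ _ -
    LinearMap.mul ℝ (ExteriorAlgebra ℝ (Fin n → ℝ)) ∘ₗ ι ℝ ∘ₗ LinearMap.fst ℝ _ _

lemma spinorAction_apply {n : ℕ} (u : (Fin n → ℝ) × (Fin n → ℝ))
    (φ : ExteriorAlgebra ℝ (Fin n → ℝ)) :
    spinorAction u φ = contractLeft (coordDual u.2) φ - ι ℝ u.1 * φ := rfl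

/-- The split pairing on `ℝⁿ × (ℝⁿ)*`. -/
def splitPairing {n : ℕ} (u v : (Fin n → ℝ) × (Fin n → ℝ)) : ℝ :=
  coordDual u.2 v.1 + coordDual v.2 u.1

lemma spinorAction_mul_add_swap {n : ℕ} (u v : (Fin n → ℝ) × (Fin n → ℝ)) :
    spinorAction u * spinorAction v + spinorAction v * spinorAction u =
      -splitPairing u v • 1 := by
  refine LinearMap.ext fun φ => ?_
  simp only [LinearMap.add_apply, Module.End.mul_apply, spinorAction_apply, map_sub,
    contractLeft_ι_mul', LinearMap.smul_apply, Module.End.one_apply, splitPairing]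
  rw [ι_mul_ι_mul_swap u.1 v.1, CliffordAlgebra.contractLeft_comm (coordDual u.2)]
  rw [neg_smul, add_smul]
  abel

lemma spinorAction_expNegHat {n : ℕ} {A : Fin n → Fin n → ℝ} (hA : ∀ i j, A i j = -A j i)
    {u : (Fin n → ℝ) × (Fin n → ℝ)} (hu : u ∈ graphBivec A) :
    spinorAction u (expNegHat A) = 0 := by
  obtain ⟨α, rfl⟩ := hu
  have h := contractLeft_expNegHat_mul hA α 1
  rw [mul_one, CliffordAlgebra.contractLeft_one, mul_zero, zero_add] at h
  rw [spinorAction_apply]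
  exact sub_eq_zero.2 h

lemma splitPairing_eq_zero_of_mem_graphBivec {n : ℕ} {A : Fin n → Fin n → ℝ}
    (hA : ∀ i j, A i j = -A j i) {u v : (Fin n → ℝ) × (Fin n → ℝ)} (hu : u ∈ graphBivec A)
    (hv : v ∈ graphBivec A) : splitPairing u v = 0 := by
  obtain ⟨α, rfl⟩ := hu
  obtain ⟨β, rfl⟩ := hv
  change coordDual α ((Matrix.of A).mulVec β) + coordDual β ((Matrix.of A).mulVec α) = 0
  simp only [coordDual_apply, Matrix.mulVec, dotProduct, Matrix.of_apply, Finset.mul_sum]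
  rw [Finset.sum_comm, ← Finset.sum_add_distrib]
  refine Finset.sum_eq_zero fun i _ => ?_
  rw [← Finset.sum_add_distrib]
  refine Finset.sum_eq_zero fun j _ => ?_
  rw [hA i j]; ring

lemma eq_sum_smul_single_prod {n : ℕ} (u : (Fin n → ℝ) × (Fin n → ℝ)) :
    u = ∑ i, u.2 i • ((0, Pi.single i 1) : (Fin n → ℝ) × (Fin n → ℝ)) +
      ∑ i, u.1 i • ((Pi.single i 1, 0) : (Fin n → ℝ) × (Fin n → ℝ)) := by
  ext j <;> simp [Prod.fst_sum, Prod.snd_sum, Finset.sum_apply, Pi.single_apply]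

lemma exists_splitPairing_eq {n : ℕ} (L : Module.Dual ℝ ((Fin n → ℝ) × (Fin n → ℝ))) :
    ∃ w, ∀ u, splitPairing u w = L u := by
  refine ⟨(fun i => L (0, Pi.single i 1), fun i => L (Pi.single i 1, 0)), fun u => ?_⟩
  conv_rhs => rw [eq_sum_smul_single_prod u]
  simp only [map_add, map_sum, map_smul, smul_eq_mul, splitPairing, coordDual_apply]
  congr 1
  exact Finset.sum_congr rfl fun i _ => mul_comm _ _

lemma exists_linearMap_apply_eq_single {ι M : Type*} [Fintype ι] [DecidableEq ι] [AddCommGroup M]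
    [Module ℝ M] {v : ι → M} (hv : LinearIndependent ℝ v) :
    ∃ g : M →ₗ[ℝ] ι → ℝ, ∀ i, g (v i) = Pi.single i 1 := by
  obtain ⟨g, hg⟩ := LinearMap.exists_leftInverse_of_injective (Fintype.linearCombination ℝ v)
    (LinearMap.ker_eq_bot.2 hv.fintypeLinearCombination_injective)
  refine ⟨g, fun i => ?_⟩
  have := LinearMap.congr_fun hg (Pi.single i 1)
  simpa [Fintype.linearCombination_apply_single] using this

lemma spinorAction_mul_swap {n : ℕ} {u v : (Fin n → ℝ) × (Fin n → ℝ)}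
    (h : splitPairing u v = 0) :
    spinorAction v * spinorAction u = (-1 : ℝ) • (spinorAction u * spinorAction v) := by
  refine LinearMap.ext fun φ => ?_
  have h' := LinearMap.congr_fun (spinorAction_mul_add_swap u v) φ
  rw [h, neg_zero, zero_smul] at h'
  rw [LinearMap.smul_apply, neg_one_smul]
  exact eq_neg_of_add_eq_zero_right h'

lemma spinorAction_mul_prod {n : ℕ} (w : (Fin n → ℝ) × (Fin n → ℝ))
    (l : List ((Fin n → ℝ) × (Fin n → ℝ))) (hl : ∀ v ∈ l, splitPairing v w = 0) :
    spinorAction w * (l.map spinorAction).prod =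
      (-1 : ℝ) ^ l.length • ((l.map spinorAction).prod * spinorAction w) := by
  induction l with
  | nil => simp
  | cons v l ih =>
    rw [List.map_cons, List.prod_cons, ← mul_assoc, spinorAction_mul_swap (hl v (by simp)),
      smul_mul_assoc, mul_assoc, ih fun u hu => hl u (by simp [hu]), List.length_cons, pow_succ',
      mul_smul_comm, mul_assoc, smul_smul]

lemma prod_spinorAction_ne_zero {n k : ℕ} (s : Fin k → (Fin n → ℝ) × (Fin n → ℝ))
    (hs : LinearIndependent ℝ s) : ((List.ofFn s).map spinorAction).prod ≠ 0 := by
  induction k with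
  | zero => simp
  | succ k ih =>
    intro h0
    refine ih (fun i => s i.succ) (hs.comp _ (Fin.succ_injective k)) ?_
    obtain ⟨g, hg⟩ := exists_linearMap_apply_eq_single hs
    obtain ⟨w, hw⟩ := exists_splitPairing_eq (LinearMap.proj 0 ∘ₗ g)
    have hw' (i) : splitPairing (s i) w = (Pi.single i (1 : ℝ) : Fin (k + 1) → ℝ) 0 := by
      rw [hw, LinearMap.comp_apply, hg]; rfl
    rw [List.ofFn_succ, List.map_cons, List.prod_cons] at h0
    have h1 := spinorAction_mul_add_swap (s 0) w
    rw [hw', Pi.single_eq_same] at h1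
    have h2 := spinorAction_mul_prod w (List.ofFn fun i => s i.succ) (by
      intro v hv
      obtain ⟨i, rfl⟩ := (List.mem_ofFn' _ _).1 hv
      rw [hw', Pi.single_eq_of_ne (Fin.succ_ne_zero i).symm])
    set Z := ((List.ofFn fun i => s i.succ).map spinorAction).prod
    have h3 : spinorAction (s 0) * (spinorAction w * Z) = 0 := by
      rw [h2, mul_smul_comm, ← mul_assoc, h0, zero_mul, smul_zero]
    have h4 : spinorAction w * (spinorAction (s 0) * Z) = 0 := by rw [h0, mul_zero]
    rw [← mul_assoc] at h3 h4
    have h5 := congrArg (· * Z) h1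
    simp only [add_mul, h3, h4, add_zero, smul_mul_assoc, one_mul] at h5
    exact (smul_eq_zero.1 h5.symm).resolve_left (by norm_num)

lemma spinorAction_mul_prod_eq_zero {n : ℕ} (l : List ((Fin n → ℝ) × (Fin n → ℝ)))
    (hl : ∀ u ∈ l, ∀ v ∈ l, splitPairing u v = 0) (v) (hv : v ∈ l) :
    spinorAction v * (l.map spinorAction).prod = 0 := by
  induction l with
  | nil => simp at hv
  | cons a l ih =>
    have h := spinorAction_mul_swap (hl a (by simp) v hv)
    rw [List.map_cons, List.prod_cons, ← mul_assoc]
    rcases List.mem_cons.1 hv with rfl | hv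
    · have h2 : (2 : ℝ) • (spinorAction v * spinorAction v) = 0 := by
        rw [two_smul]
        nth_rewrite 1 [h]
        rw [neg_one_smul ℝ (spinorAction v * spinorAction v), neg_add_cancel]
      rw [(smul_eq_zero.1 h2).resolve_left two_ne_zero, zero_mul]
    · rw [h, smul_mul_assoc, mul_assoc,
        ih (fun u hu w hw => hl u (by simp [hu]) w (by simp [hw])) hv, mul_zero, smul_zero]

lemma spinorAction_eq_sum {n : ℕ} (u : (Fin n → ℝ) × (Fin n → ℝ)) :
    spinorAction u = ∑ i, u.2 i • spinorAction (0, Pi.single i 1) +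
      ∑ i, u.1 i • spinorAction (Pi.single i 1, 0) := by
  conv_lhs => rw [eq_sum_smul_single_prod u]
  simp only [map_add, map_sum, map_smul]

lemma contDiffOn_prod_spinorAction {n : ℕ} {V : Set (Fin n → ℝ)} {k : ℕ}
    {s : Fin k → (Fin n → ℝ) → (Fin n → ℝ) × (Fin n → ℝ)}
    (hs : ∀ i, ContDiffOn ℝ (⊤ : ℕ∞) (s i) V) (Ω : ExteriorAlgebra ℝ (Fin n → ℝ))
    (L : Module.Dual ℝ (ExteriorAlgebra ℝ (Fin n → ℝ))) :
    ContDiffOn ℝ (⊤ : ℕ∞)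
      (fun x => L (((List.ofFn fun i => s i x).map spinorAction).prod Ω)) V := by
  induction k generalizing L with
  | zero => simpa using contDiffOn_const
  | succ k ih =>
    have h1 (i) : ContDiffOn ℝ (⊤ : ℕ∞) (fun x => (s 0 x).1 i) V :=
      contDiffOn_pi.1 (hs 0).fst i
    have h2 (i) : ContDiffOn ℝ (⊤ : ℕ∞) (fun x => (s 0 x).2 i) V :=
      contDiffOn_pi.1 (hs 0).snd i
    have key (u : (Fin n → ℝ) × (Fin n → ℝ)) (φ : ExteriorAlgebra ℝ (Fin n → ℝ)) :
        L (spinorAction u φ) = ∑ i, u.2 i * (L ∘ₗ spinorAction (0, Pi.single i 1)) φ +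
          ∑ i, u.1 i * (L ∘ₗ spinorAction (Pi.single i 1, 0)) φ := by
      rw [spinorAction_eq_sum u]
      simp only [LinearMap.add_apply, LinearMap.sum_apply, LinearMap.smul_apply, map_add, map_sum,
        map_smul, smul_eq_mul, LinearMap.comp_apply]
    simp only [List.ofFn_succ, List.map_cons, List.prod_cons, Module.End.mul_apply, key]
    exact (ContDiffOn.sum fun i _ => (h2 i).mul (ih (fun j => hs j.succ) _)).add
      (ContDiffOn.sum fun i _ => (h1 i).mul (ih (fun j => hs j.succ) _))

lemma contDiffOn_dual_of_monCoeff {n : ℕ} {V : Set (Fin n → ℝ)}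
    {ψ : (Fin n → ℝ) → ExteriorAlgebra ℝ (Fin n → ℝ)}
    (hψ : ∀ T : Finset (Fin n), ContDiffOn ℝ (⊤ : ℕ∞) (fun x => monCoeff T (ψ x)) V)
    (L : Module.Dual ℝ (ExteriorAlgebra ℝ (Fin n → ℝ))) :
    ContDiffOn ℝ (⊤ : ℕ∞) (fun x => L (ψ x)) V := by
  induction dual_mem_span_monCoeffLinear L using Submodule.span_induction with
  | mem L hL =>
    obtain ⟨T, rfl⟩ := hL
    simpa only [monCoeffLinear_apply] using hψ T
  | zero => exact contDiffOn_const
  | add L L' _ _ h h' => exact h.add h'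
  | smul c L _ h => exact h.const_smul c

lemma contDiffOn_det {E ι : Type*} [NormedAddCommGroup E] [NormedSpace ℝ E] [Fintype ι]
    [DecidableEq ι] {V : Set E} {G : E → Matrix ι ι ℝ}
    (hG : ∀ i j, ContDiffOn ℝ (⊤ : ℕ∞) (fun x => G x i j) V) :
    ContDiffOn ℝ (⊤ : ℕ∞) (fun x => (G x).det) V := by
  simp only [Matrix.det_apply]
  exact ContDiffOn.sum fun p _ => (contDiffOn_prod fun i _ => hG (p i) i).const_smul _

lemma contDiffOn_adjugate {E ι : Type*} [NormedAddCommGroup E] [NormedSpace ℝ E] [Fintype ι]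
    [DecidableEq ι] {V : Set E} {G : E → Matrix ι ι ℝ}
    (hG : ∀ i j, ContDiffOn ℝ (⊤ : ℕ∞) (fun x => G x i j) V) (i j : ι) :
    ContDiffOn ℝ (⊤ : ℕ∞) (fun x => (G x).adjugate i j) V := by
  simp only [Matrix.adjugate_apply]
  refine contDiffOn_det fun k l => ?_
  simp only [Matrix.updateRow_apply]
  split_ifs
  · exact contDiffOn_const
  · exact hG k l

lemma finrank_graphBivec {n : ℕ} (A : Fin n → Fin n → ℝ) :
    Module.finrank ℝ (graphBivec A) = n := by
  rw [graphBivec, LinearMap.finrank_range_of_inj, Module.finrank_fin_fun]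
  intro α β h
  exact congrArg Prod.snd h

/-- The annihilator of a nonzero spinor is isotropic, hence of dimension at most `n`. -/
lemma finrank_ker_spinorAction_le {n : ℕ} {φ : ExteriorAlgebra ℝ (Fin n → ℝ)} (hφ : φ ≠ 0) :
    Module.finrank ℝ (LinearMap.ker (spinorAction.flip φ)) ≤ n := by
  set N := LinearMap.ker (spinorAction.flip φ) with hN
  have hiso : ∀ u ∈ N, ∀ v ∈ N, splitPairing u v = 0 := by
    intro u hu v hv
    have h := LinearMap.congr_fun (spinorAction_mul_add_swap u v) φ
    have hu' : spinorAction u φ = 0 := hu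
    have hv' : spinorAction v φ = 0 := hv
    simp only [LinearMap.add_apply, Module.End.mul_apply, hu', hv', map_zero, add_zero,
      LinearMap.smul_apply, Module.End.one_apply] at h
    simpa [hφ] using h.symm
  let e := LinearEquiv.prodComm ℝ (Fin n → ℝ) (Fin n → ℝ)
  have hdisj : N ⊓ N.map e.toLinearMap = ⊥ := by
    refine (Submodule.eq_bot_iff _).2 ?_
    rintro _ ⟨hu, u, hu', rfl⟩
    have h := hiso u hu' _ hu
    change coordDual u.2 u.2 + coordDual u.1 u.1 = 0 at h
    simp only [coordDual_apply] at h
    have h2 : ∑ i, u.2 i * u.2 i = 0 ∧ ∑ i, u.1 i * u.1 i = 0 :=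
      (add_eq_zero_iff_of_nonneg (Finset.sum_nonneg fun i _ => mul_self_nonneg _)
        (Finset.sum_nonneg fun i _ => mul_self_nonneg _)).1 h
    rw [Finset.sum_eq_zero_iff_of_nonneg fun i _ => mul_self_nonneg _,
      Finset.sum_eq_zero_iff_of_nonneg fun i _ => mul_self_nonneg _] at h2
    have : u = 0 := by
      ext i
      · exact mul_self_eq_zero.1 (h2.2 i (Finset.mem_univ i))
      · exact mul_self_eq_zero.1 (h2.1 i (Finset.mem_univ i))
    rw [this, map_zero]
  have h1 := Submodule.finrank_sup_add_finrank_inf_eq N (N.map e.toLinearMap)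
  have h2 := Submodule.finrank_le (N ⊔ N.map e.toLinearMap)
  have h3 : Module.finrank ℝ (N.map e.toLinearMap) = Module.finrank ℝ N :=
    LinearEquiv.finrank_map_eq e N
  rw [hdisj, finrank_bot, h3] at h1
  rw [Module.finrank_prod, Module.finrank_fin_fun] at h2
  omega

lemma exists_smooth_spinor_of_removable {n : ℕ} {U S : Set (Fin n → ℝ)}
    {P : (Fin n → ℝ) → Fin n → Fin n → ℝ} (hP : ∀ x ∈ U \ S, ∀ i j, P x i j = -P x j i)
    {m : Fin n → ℝ} (h : PoissonRemovableAt U S P m) :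
    ∃ (V : Set (Fin n → ℝ)) (f : (Fin n → ℝ) → ℝ)
      (ψ : (Fin n → ℝ) → ExteriorAlgebra ℝ (Fin n → ℝ)),
      IsOpen V ∧ m ∈ V ∧ V ⊆ U ∧
      ContDiffOn ℝ (⊤ : ℕ∞) f V ∧
      (∀ T : Finset (Fin n), ContDiffOn ℝ (⊤ : ℕ∞) (fun x => monCoeff T (ψ x)) V) ∧
      (∀ x ∈ V, ψ x ≠ 0) ∧
      ∀ x ∈ V \ S, ψ x = f x • expNegHat (P x) := by
  obtain ⟨V, s, hV, hmV, hVU, hs, hind, hspan⟩ := h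
  obtain ⟨Ω, hΩ⟩ : ∃ Ω, ((List.ofFn fun i => s i m).map spinorAction).prod Ω ≠ 0 := by
    by_contra! h0
    exact prod_spinorAction_ne_zero _ (hind m hmV) (LinearMap.ext h0)
  set ψ : (Fin n → ℝ) → ExteriorAlgebra ℝ (Fin n → ℝ) :=
    fun x => ((List.ofFn fun i => s i x).map spinorAction).prod Ω with hψ
  have hsm (L : Module.Dual ℝ (ExteriorAlgebra ℝ (Fin n → ℝ))) :
      ContDiffOn ℝ (⊤ : ℕ∞) (fun x => L (ψ x)) V := contDiffOn_prod_spinorAction hs Ω L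
  obtain ⟨J, hJ⟩ : ∃ J, monCoeff J (ψ m) ≠ 0 := by
    by_contra! h0
    exact hΩ (eq_zero_of_monCoeff_eq_zero h0)
  simp only [← monCoeffLinear_apply] at hJ ⊢
  have hsub : V ∩ (fun x => monCoeffLinear J (ψ x)) ⁻¹' {0}ᶜ ⊆ V := Set.inter_subset_left
  refine ⟨V ∩ (fun x => monCoeffLinear J (ψ x)) ⁻¹' {0}ᶜ,
    fun x => algebraMapInv.toLinearMap (ψ x), ψ,
    (hsm _).continuousOn.isOpen_inter_preimage hV isOpen_compl_singleton, ⟨hmV, hJ⟩,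
    hsub.trans hVU, (hsm _).mono hsub, fun T => (hsm _).mono hsub, ?_, ?_⟩
  · rintro x ⟨-, hx⟩ h0
    exact hx (by simp [h0])
  · rintro x ⟨⟨hxV, -⟩, hxS⟩
    have hA := hP x ⟨hVU hxV, hxS⟩
    have hsp := hspan x ⟨hxV, hxS⟩
    have hmem (i) : s i x ∈ graphBivec (P x) := hsp ▸ Submodule.subset_span ⟨i, rfl⟩
    have hle : graphBivec (P x) ≤ LinearMap.ker (spinorAction.flip (ψ x)) := by
      rw [← hsp, Submodule.span_le]
      rintro _ ⟨i, rfl⟩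
      refine LinearMap.congr_fun (spinorAction_mul_prod_eq_zero (List.ofFn fun i => s i x)
        (fun u hu v hv => ?_) (s i x) ((List.mem_ofFn' _ _).2 ⟨i, rfl⟩)) Ω
      obtain ⟨j, rfl⟩ := (List.mem_ofFn' _ _).1 hu
      obtain ⟨k, rfl⟩ := (List.mem_ofFn' _ _).1 hv
      exact splitPairing_eq_zero_of_mem_graphBivec hA (hmem j) (hmem k)
    exact eq_smul_expNegHat hA fun α => sub_eq_zero.1 (hle ⟨α, rfl⟩)

lemma removable_of_exists_smooth_spinor {n : ℕ} {U S : Set (Fin n → ℝ)}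
    {P : (Fin n → ℝ) → Fin n → Fin n → ℝ} (hP : ∀ x ∈ U \ S, ∀ i j, P x i j = -P x j i)
    {m : Fin n → ℝ} {V : Set (Fin n → ℝ)} {f : (Fin n → ℝ) → ℝ}
    {ψ : (Fin n → ℝ) → ExteriorAlgebra ℝ (Fin n → ℝ)} (hV : IsOpen V) (hmV : m ∈ V) (hVU : V ⊆ U)
    (hψ : ∀ T : Finset (Fin n), ContDiffOn ℝ (⊤ : ℕ∞) (fun x => monCoeff T (ψ x)) V)
    (hψm : ψ m ≠ 0) (hψP : ∀ x ∈ V \ S, ψ x = f x • expNegHat (P x)) :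
    PoissonRemovableAt U S P m := by
  have hrank : n ≤ Module.finrank ℝ (LinearMap.range (spinorAction.flip (ψ m))) := by
    have h1 := LinearMap.finrank_range_add_finrank_ker (spinorAction.flip (ψ m))
    have h2 := finrank_ker_spinorAction_le hψm
    rw [Module.finrank_prod, Module.finrank_fin_fun] at h1
    omega
  obtain ⟨y, hy⟩ := exists_linearIndependent_of_le_finrank hrank
  choose v hv using fun i => (y i).2
  obtain ⟨g, hg⟩ := exists_linearMap_apply_eq_single
    (hy.map' (Submodule.subtype _) (Submodule.ker_subtype _))
  let H (x : Fin n → ℝ) : (Fin n → ℝ) × (Fin n → ℝ) →ₗ[ℝ] Fin n → ℝ :=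
    g ∘ₗ spinorAction.flip (ψ x)
  have hHv (j) : H m (v j) = Pi.single j 1 := by
    rw [← hg]
    exact congrArg g (hv j)
  have hsmH (u) (k) : ContDiffOn ℝ (⊤ : ℕ∞) (fun x => H x u k) V :=
    contDiffOn_dual_of_monCoeff hψ (LinearMap.proj k ∘ₗ g ∘ₗ spinorAction u)
  let G (x : Fin n → ℝ) : Matrix (Fin n) (Fin n) ℝ := Matrix.of fun k j => H x (v j) k
  have hGm : G m = 1 := by
    ext k j
    simp [G, hHv, Matrix.one_apply, Pi.single_apply]
  have hsmG (k j) : ContDiffOn ℝ (⊤ : ℕ∞) (fun x => G x k j) V := hsmH (v j) k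
  have hHG (x) (c : Fin n → ℝ) : H x (∑ j, c j • v j) = (G x).mulVec c := by
    ext k
    simp [G, Matrix.mulVec, dotProduct, mul_comm]
  have hker (x) (hx : (G x).det ≠ 0) : Module.finrank ℝ (LinearMap.ker (H x)) = n := by
    have h1 := LinearMap.finrank_range_add_finrank_ker (H x)
    rw [LinearMap.range_eq_top.2, finrank_top, Module.finrank_prod, Module.finrank_fin_fun] at h1
    · omega
    · intro c
      obtain ⟨b, hb⟩ := (Matrix.mulVec_surjective_iff_isUnit.2
        ((Matrix.isUnit_iff_isUnit_det _).2 hx.isUnit)) c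
      exact ⟨_, (hHG x b).trans hb⟩
  let d := Module.finBasisOfFinrankEq ℝ _ (hker m (by simp [hGm]))
  let c (i : Fin n) (x : Fin n → ℝ) : Fin n → ℝ := (G x).adjugate.mulVec (H x (d i))
  let s (i : Fin n) (x : Fin n → ℝ) : (Fin n → ℝ) × (Fin n → ℝ) :=
    (G x).det • (d i : (Fin n → ℝ) × (Fin n → ℝ)) - ∑ j, c i x j • v j
  have hsub : V ∩ (fun x => (G x).det) ⁻¹' {0}ᶜ ⊆ V := Set.inter_subset_left
  have hsmd := contDiffOn_det hsmG
  have hind (x) (hx : (G x).det ≠ 0) : LinearIndependent ℝ fun i => s i x := by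
    rw [Fintype.linearIndependent_iff]
    intro a ha
    have h1 : (G x).det • ∑ i, a i • (d i : (Fin n → ℝ) × (Fin n → ℝ)) =
        ∑ j, (∑ i, a i * c i x j) • v j := by
      rw [← sub_eq_zero, ← ha]
      simp only [s, smul_sub, Finset.sum_sub_distrib, Finset.smul_sum, Finset.sum_smul, mul_smul]
      congr 1
      · exact Finset.sum_congr rfl fun i _ => smul_comm _ _ _
      · exact Finset.sum_comm
    have h2 := congrArg (H m) h1
    have h3 (i) : H m (d i) = 0 := (d i).2
    rw [hHG, hGm, Matrix.one_mulVec, map_smul, map_sum] at h2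
    simp only [map_smul, h3, smul_zero, Finset.sum_const_zero] at h2
    have h4 (j) : ∑ i, a i * c i x j = 0 := (congrFun h2 j).symm
    simp only [h4, zero_smul, Finset.sum_const_zero] at h1
    have h5 := (smul_eq_zero.1 h1).resolve_left hx
    refine Fintype.linearIndependent_iff.1 d.linearIndependent a (Subtype.ext ?_)
    simpa using h5
  refine ⟨V ∩ (fun x => (G x).det) ⁻¹' {0}ᶜ, s,
    hsmd.continuousOn.isOpen_inter_preimage hV isOpen_compl_singleton,
    ⟨hmV, by simp [hGm]⟩, hsub.trans hVU, fun i => ?_, fun x hx => hind x hx.2, ?_⟩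
  · refine ContDiffOn.mono ?_ hsub
    have hc (j) : ContDiffOn ℝ (⊤ : ℕ∞) (fun x => c i x j) V := by
      simp only [c, Matrix.mulVec, dotProduct]
      exact ContDiffOn.sum fun k _ => (contDiffOn_adjugate hsmG j k).mul (hsmH _ k)
    exact (hsmd.smul contDiffOn_const).sub
      (ContDiffOn.sum fun j _ => (hc j).smul contDiffOn_const)
  · rintro x ⟨⟨hxV, hx⟩, hxS⟩
    have hA := hP x ⟨hVU hxV, hxS⟩
    have h1 : graphBivec (P x) ≤ LinearMap.ker (H x) := by
      intro u hu
      change g (spinorAction u (ψ x)) = 0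
      rw [hψP x ⟨hxV, hxS⟩, map_smul, spinorAction_expNegHat hA hu, smul_zero, map_zero]
    have h2 : Submodule.span ℝ (Set.range fun i => s i x) ≤ LinearMap.ker (H x) := by
      rw [Submodule.span_le]
      rintro _ ⟨i, rfl⟩
      change H x ((G x).det • _ - _) = 0
      rw [map_sub, map_smul, hHG, Matrix.mulVec_mulVec, Matrix.mul_adjugate, Matrix.smul_mulVec,
        Matrix.one_mulVec, sub_self]
    rw [Submodule.eq_of_le_of_finrank_eq h1 (by rw [finrank_graphBivec, hker x hx]),
      Submodule.eq_of_le_of_finrank_eq h2 (by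
        rw [finrank_span_eq_card (hind x hx), hker x hx, Fintype.card_fin])]



/-- (Prop. `PoissonSpinorRemove`, trivialized form.)  A singular
Poisson bivector `P` on `U∖S` with a singularity at `m ∈ S` has a removable
singularity at `m` iff near `m` there are a smooth function `f` and a smooth
nowhere-vanishing multivector field `ψ : V → Λℝⁿ` with `ψ = f·e^{-Π̂}` off `S`.
(Here `Π̂ = Σ_{i<j} Π_{ij} eᵢ ∧ eⱼ`, and smoothness of `ψ` is expressed by
smoothness of all its wedge-monomial coefficients.) -/
theorem stmt_19 {n : ℕ} (hn : 2 ≤ n) (U S : Set (Fin n → ℝ))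
    (hU : IsOpen U) (hSU : S ⊆ U) (hUS : IsOpen (U \ S)) (hdense : U ⊆ closure (U \ S))
    (P : (Fin n → ℝ) → Fin n → Fin n → ℝ)
    (hP : IsSingularPoisson U S P)
    (m : Fin n → ℝ) (hm : m ∈ S) (hsing : PoissonHasSingularityAt U S P m) :
    PoissonRemovableAt U S P m ↔
      ∃ (V : Set (Fin n → ℝ)) (f : (Fin n → ℝ) → ℝ)
        (ψ : (Fin n → ℝ) → ExteriorAlgebra ℝ (Fin n → ℝ)),
        IsOpen V ∧ m ∈ V ∧ V ⊆ U ∧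
        ContDiffOn ℝ (⊤ : ℕ∞) f V ∧
        (∀ T : Finset (Fin n), ContDiffOn ℝ (⊤ : ℕ∞) (fun x => monCoeff T (ψ x)) V) ∧
        (∀ x ∈ V, ψ x ≠ 0) ∧
        ∀ x ∈ V \ S, ψ x = f x • expNegHat (P x) := by
  constructor
  · exact exists_smooth_spinor_of_removable hP.2.1
  · rintro ⟨V, f, ψ, hV, hmV, hVU, -, hψ, hψ0, hψP⟩
    exact removable_of_exists_smooth_spinor hP.2.1 hV hmV hVU hψ (hψ0 m hmV) hψP

end
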